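/- arXiv:2311.03703 — 6 statements merged into one kernel-verified Lean document; each statement's English description precedes it below -/
import Mathlib

section
/- Let G = (V,E) be a computation graph on a nonempty vertex set with work : V → ℝ≥0, size_out : V → ℝ≥0, B > 0, and let k ≥ 1. Let L = max( max_{v ∈ V} work(v), (1/k)·Σ_{v ∈ V} work(v) ). Then the optimal value of the three-superblock relaxation, namely the minimum over all DAG-respecting 3-partitions g : V → {1,2,3} satisfying Σ_{v : g(v)=2} work(v) ≥ L of the cost of block 2 under g, is at most OPT, the MTPP optimum over DAG-respecting k-partitions. (In particular this relaxation value is a valid lower bound on OPT.) -/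
open Finset

attribute [local instance] Classical.propDecidable

/-- The edge relation of `E` is acyclic (no directed cycles), i.e. `G` is a DAG. -/
def IsAcyclicRel {V : Type*} (E : Finset (V × V)) : Prop :=
  ∀ v : V, ¬ Relation.TransGen (fun a b : V => (a, b) ∈ E) v v

/-- Total `work` of the nodes assigned to block `b` by the partition `f`. -/
noncomputable def blockWork {V : Type*} [Fintype V] (work : V → NNReal)
    (f : V → ℕ) (b : ℕ) : ℝ :=
  ∑ v ∈ Finset.univ.filter (fun v => f v = b), (work v : ℝ)

/-- Cut cost of block `b` under the partition `f`: `(1/B)` times the sum of `sizeOut u`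
over all nodes `u` having an edge `(u,v) ∈ E` with `f u < b = f v` or `f u = b < f v`,
each such `u` counted once. -/
noncomputable def cutCost {V : Type*} [Fintype V] (E : Finset (V × V)) (sizeOut : V → NNReal)
    (B : NNReal) (f : V → ℕ) (b : ℕ) : ℝ :=
  (1 / (B : ℝ)) * ∑ u ∈ Finset.univ.filter
      (fun u => ∃ v, (u, v) ∈ E ∧ ((f u < b ∧ f v = b) ∨ (f u = b ∧ b < f v))),
    (sizeOut u : ℝ)

/-- Cost of block `b` under `f`: work of the block plus its cut cost. -/
noncomputable def blockCost {V : Type*} [Fintype V] (E : Finset (V × V))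
    (work sizeOut : V → NNReal) (B : NNReal) (f : V → ℕ) (b : ℕ) : ℝ :=
  blockWork work f b + cutCost E sizeOut B f b

/-- Bottleneck cost of a `k`-partition `f`: the maximum block cost over blocks `1,…,k`. -/
noncomputable def bottleneck {V : Type*} [Fintype V] (E : Finset (V × V))
    (work sizeOut : V → NNReal) (B : NNReal) (k : ℕ) (hk : 1 ≤ k) (f : V → ℕ) : ℝ :=
  (Finset.Icc 1 k).sup' (Finset.nonempty_Icc.mpr hk) (blockCost E work sizeOut B f)

/-- The MTPP optimum: minimum bottleneck cost over all DAG-respecting `k`-partitions. -/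
noncomputable def OPT {V : Type*} [Fintype V] (E : Finset (V × V))
    (work sizeOut : V → NNReal) (B : NNReal) (k : ℕ) (hk : 1 ≤ k) : ℝ :=
  sInf {r : ℝ | ∃ f : V → ℕ, (∀ v, f v ∈ Finset.Icc 1 k) ∧ (∀ e ∈ E, f e.1 ≤ f e.2) ∧
    bottleneck E work sizeOut B k hk f = r}

/-- The simple combinatorial lower bound
`L = max(max_v work v, (1/k) Σ_v work v)`. -/
noncomputable def simpleLB {V : Type*} [Fintype V] [Nonempty V]
    (work : V → NNReal) (k : ℕ) : ℝ :=
  max (Finset.univ.sup' Finset.univ_nonempty (fun v => (work v : ℝ)))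
      ((∑ v, (work v : ℝ)) / k)

/-- Aggregated cost of the superblock `S`: total work of the nodes assigned to blocks in `S`
plus `(1/B)` times the sum of `sizeOut u` over nodes `u` having an edge `(u,v) ∈ E` with
exactly one of `f u`, `f v` in `S` (each such `u` counted once). -/
noncomputable def aggCost {V : Type*} [Fintype V] (E : Finset (V × V))
    (work sizeOut : V → NNReal) (B : NNReal) (f : V → ℕ) (S : Finset ℕ) : ℝ :=
  (∑ v ∈ Finset.univ.filter (fun v => f v ∈ S), (work v : ℝ)) +
  (1 / (B : ℝ)) * ∑ u ∈ Finset.univ.filter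
      (fun u => ∃ v, (u, v) ∈ E ∧ ((f u ∈ S ∧ f v ∉ S) ∨ (f u ∉ S ∧ f v ∈ S))),
    (sizeOut u : ℝ)

/-- Contract the blocks below `b` to block `1`, the block `b` to block `2`, and the blocks
above `b` to block `3`. -/
def threeSuperblocks (b n : ℕ) : ℕ :=
  if n < b then 1 else if n = b then 2 else 3

lemma threeSuperblocks_mem_Icc (b n : ℕ) : threeSuperblocks b n ∈ Finset.Icc 1 3 := by
  unfold threeSuperblocks
  split_ifs <;> decide

lemma threeSuperblocks_mono (b : ℕ) : Monotone (threeSuperblocks b) := by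
  intro m n h
  unfold threeSuperblocks
  split_ifs <;> omega

lemma threeSuperblocks_eq_two {b n : ℕ} : threeSuperblocks b n = 2 ↔ n = b := by
  unfold threeSuperblocks
  split_ifs <;> omega

lemma threeSuperblocks_lt_two {b n : ℕ} : threeSuperblocks b n < 2 ↔ n < b := by
  unfold threeSuperblocks
  split_ifs <;> omega

lemma two_lt_threeSuperblocks {b n : ℕ} : 2 < threeSuperblocks b n ↔ b < n := by
  unfold threeSuperblocks
  split_ifs <;> omega

lemma blockWork_threeSuperblocks {V : Type*} [Fintype V] (work : V → NNReal) (f : V → ℕ)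
    (b : ℕ) : blockWork work (fun v => threeSuperblocks b (f v)) 2 = blockWork work f b := by
  simp only [blockWork, threeSuperblocks_eq_two]

lemma blockCost_threeSuperblocks {V : Type*} [Fintype V] (E : Finset (V × V))
    (work sizeOut : V → NNReal) (B : NNReal) (f : V → ℕ) (b : ℕ) :
    blockCost E work sizeOut B (fun v => threeSuperblocks b (f v)) 2 =
      blockCost E work sizeOut B f b := by
  simp only [blockCost, blockWork_threeSuperblocks, cutCost, threeSuperblocks_eq_two,
    threeSuperblocks_lt_two, two_lt_threeSuperblocks]

lemma blockCost_nonneg {V : Type*} [Fintype V] (E : Finset (V × V))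
    (work sizeOut : V → NNReal) (B : NNReal) (f : V → ℕ) (b : ℕ) :
    0 ≤ blockCost E work sizeOut B f b := by
  unfold blockCost blockWork cutCost
  positivity

/-- The block of a node carries at least the work of that node. -/
lemma work_le_blockWork {V : Type*} [Fintype V] (work : V → NNReal) (f : V → ℕ) (v : V) :
    (work v : ℝ) ≤ blockWork work f (f v) :=
  Finset.single_le_sum (f := fun v => (work v : ℝ)) (fun _ _ => NNReal.coe_nonneg _)
    (by simp)

/-- Some block of a `k`-partition carries at least the average work. -/
lemma exists_average_le_blockWork {V : Type*} [Fintype V] (work : V → NNReal) {k : ℕ}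
    (hk : 1 ≤ k) (f : V → ℕ) (hf : ∀ v, f v ∈ Finset.Icc 1 k) :
    ∃ b ∈ Finset.Icc 1 k, (∑ v, (work v : ℝ)) / k ≤ blockWork work f b := by
  refine Finset.exists_le_of_sum_le (Finset.nonempty_Icc.mpr hk) ?_
  have hk' : (k : ℝ) ≠ 0 := by positivity
  unfold blockWork
  rw [Finset.sum_fiberwise_of_maps_to fun v _ => hf v, Finset.sum_const, Nat.card_Icc,
    Nat.add_sub_cancel, nsmul_eq_mul, mul_div_cancel₀ _ hk']

/-- Some block of a `k`-partition carries work at least `simpleLB`. -/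
lemma exists_simpleLB_le_blockWork {V : Type*} [Fintype V] [Nonempty V] (work : V → NNReal)
    {k : ℕ} (hk : 1 ≤ k) (f : V → ℕ) (hf : ∀ v, f v ∈ Finset.Icc 1 k) :
    ∃ b ∈ Finset.Icc 1 k, simpleLB work k ≤ blockWork work f b := by
  unfold simpleLB
  obtain ⟨v, -, hv⟩ := Finset.exists_mem_eq_sup' (Finset.univ_nonempty (α := V))
    (fun v => (work v : ℝ))
  obtain ⟨b, hb, havg⟩ := exists_average_le_blockWork work hk f hf
  rcases le_total (Finset.univ.sup' Finset.univ_nonempty fun v => (work v : ℝ))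
    ((∑ v, (work v : ℝ)) / k) with h | h
  · exact ⟨b, hb, (max_eq_right h).trans_le havg⟩
  · exact ⟨f v, hf v, (max_eq_left h).trans_le (hv.trans_le (work_le_blockWork work f v))⟩

/-- Corollary 3.3: the optimal value of the three-superblock relaxation —
the minimum cost of block `2` over all DAG-respecting `3`-partitions `g` whose block `2`
carries work at least `L = max(max_v work v, (1/k) Σ_v work v)` — is a lower bound on the
MTPP optimum over DAG-respecting `k`-partitions. -/
theorem stmt5 {V : Type*} [Fintype V] [Nonempty V] (E : Finset (V × V))
    (hacyc : IsAcyclicRel E) (work sizeOut : V → NNReal) (B : NNReal) (hB : 0 < B)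
    (k : ℕ) (hk : 1 ≤ k) :
    sInf {r : ℝ | ∃ g : V → ℕ, (∀ v, g v ∈ Finset.Icc 1 3) ∧ (∀ e ∈ E, g e.1 ≤ g e.2) ∧
        simpleLB work k ≤ blockWork work g 2 ∧ blockCost E work sizeOut B g 2 = r}
      ≤ OPT E work sizeOut B k hk := by
  refine le_csInf ⟨_, fun _ => 1, fun _ => Finset.mem_Icc.mpr ⟨le_rfl, hk⟩,
    fun _ _ => le_rfl, rfl⟩ ?_
  rintro _ ⟨f, hf, hE, rfl⟩
  obtain ⟨b, hb, hL⟩ := exists_simpleLB_le_blockWork work hk f hf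
  calc
    _ ≤ blockCost E work sizeOut B f b := by
      refine csInf_le ⟨0, ?_⟩ ⟨fun v => threeSuperblocks b (f v),
        fun v => threeSuperblocks_mem_Icc b (f v),
        fun e he => threeSuperblocks_mono b (hE e he),
        hL.trans_eq (blockWork_threeSuperblocks work f b).symm,
        blockCost_threeSuperblocks E work sizeOut B f b⟩
      rintro _ ⟨g, -, -, -, rfl⟩
      exact blockCost_nonneg E work sizeOut B g 2
    _ ≤ bottleneck E work sizeOut B k hk f :=
      Finset.le_sup' (blockCost E work sizeOut B f) hb
end

section
/- Let G = (V,E) be a computation graph with work : V → ℝ≥0, size_out : V → ℝ≥0, B > 0, let f : V → {1,…,k} be a DAG-respecting k-partition, and let S ⊆ {1,…,k} be a nonempty set of blocks. Define the aggregated cost of the superblock S as Σ_{v : f(v) ∈ S} work(v) plus (1/B)·Σ of size_out(u) over all nodes u such that there exists an edge (u,v) ∈ E with exactly one of f(u), f(v) in S (each such u counted once). Then the aggregated cost of S is at most Σ_{b ∈ S} cost(b), the sum of the individual block costs of the blocks in S. -/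
open Finset

attribute [local instance] Classical.propDecidable

/-- The total work of the nodes assigned to blocks in `S` is the sum of the block works. -/
lemma sum_blockWork {V : Type*} [Fintype V] (work : V → NNReal) (f : V → ℕ) (S : Finset ℕ) :
    ∑ b ∈ S, blockWork work f b =
      ∑ v ∈ Finset.univ.filter (fun v => f v ∈ S), (work v : ℝ) := by
  unfold blockWork
  convert Finset.sum_fiberwise_eq_sum_filter Finset.univ S f (fun v => (work v : ℝ))

/-- If every point satisfying `p` satisfies some `q b` with `b ∈ S`, then the sum of a nonnegative
function over `p` is at most the sum over `b ∈ S` of its sums over `q b`. -/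
lemma sum_filter_le_sum_sum_filter {ι κ : Type*} (s : Finset ι) (S : Finset κ) (p : ι → Prop)
    (q : κ → ι → Prop) [DecidablePred p]
    [∀ b, DecidablePred (q b)] (g : ι → ℝ) (hg : ∀ u, 0 ≤ g u)
    (h : ∀ u, p u → ∃ b ∈ S, q b u) :
    ∑ u ∈ s.filter p, g u ≤ ∑ b ∈ S, ∑ u ∈ s.filter (q b), g u := by
  simp only [Finset.sum_filter]
  rw [Finset.sum_comm]
  refine Finset.sum_le_sum fun u _ => ?_
  have hnonneg : ∀ b ∈ S, 0 ≤ if q b u then g u else 0 := fun b _ => by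
    split_ifs <;> simp [hg u]
  split_ifs with hp
  · obtain ⟨b, hb, hq⟩ := h u hp
    simpa [hq] using Finset.single_le_sum hnonneg hb
  · exact Finset.sum_nonneg hnonneg

/-- for a DAG-respecting `k`-partition `f` and a nonempty set of blocks
`S ⊆ {1,…,k}`, the aggregated cost of the superblock `S` is at most the sum of the
individual block costs of the blocks in `S`. -/
theorem stmt6 {V : Type*} [Fintype V] (E : Finset (V × V)) (hacyc : IsAcyclicRel E)
    (work sizeOut : V → NNReal) (B : NNReal) (hB : 0 < B)
    (k : ℕ) (hk : 1 ≤ k) (f : V → ℕ) (hf : ∀ v, f v ∈ Finset.Icc 1 k)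
    (hfE : ∀ e ∈ E, f e.1 ≤ f e.2)
    (S : Finset ℕ) (hS : S ⊆ Finset.Icc 1 k) (hSne : S.Nonempty) :
    aggCost E work sizeOut B f S ≤ ∑ b ∈ S, blockCost E work sizeOut B f b := by
  unfold aggCost blockCost
  rw [Finset.sum_add_distrib, sum_blockWork]
  unfold cutCost
  rw [← Finset.mul_sum]
  gcongr
  refine sum_filter_le_sum_sum_filter _ _ _ _ _ (fun u => (sizeOut u).coe_nonneg) ?_
  rintro u ⟨v, huv, ⟨hu, hv⟩ | ⟨hu, hv⟩⟩
  · exact ⟨f u, hu, v, huv, .inr ⟨rfl, (hfE _ huv).lt_of_ne fun h => hv (h ▸ hu)⟩⟩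
  · exact ⟨f v, hv, v, huv, .inl ⟨(hfE _ huv).lt_of_ne fun h => hu (h ▸ hv), rfl⟩⟩
end

section
/- Let G = (V,E) be a finite directed graph, k ≥ 1, and let f : V → {1,…,k} be any function. Define y(v,b) = 1 if f(v) ≤ b and 0 otherwise (for b ∈ {0,…,k}), and x(v,b) = y(v,b) − y(v,b−1) for b ∈ {1,…,k}. Let c : V × {1,…,k} → ℝ satisfy, for every edge (u,v) ∈ E and every b ∈ {1,…,k}: c(u,b) ≥ y(u,b−1) + x(v,b) − 1, c(u,b) ≥ x(u,b) − y(v,b), and c(u,b) ≥ 0. Then for every u ∈ V and b ∈ {1,…,k}, c(u,b) ≥ 1 whenever there exists an edge (u,v) ∈ E with f(u) < b = f(v) or with f(u) = b < f(v). Moreover, the assignment c(u,b) = 1 if such an edge exists and c(u,b) = 0 otherwise satisfies all of these constraints; hence this indicator is the pointwise-minimal feasible c. -/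
open Finset

attribute [local instance] Classical.propDecidable

/-- correctness of the tensor edge-cut constraints: for a partition
`f : V → {1,…,k}` with induced binary variables `y v b = [f v ≤ b]` and
`x v b = y v b − y v (b−1)`, any `c` satisfying the MIP constraints
`c u b ≥ y u (b−1) + x v b − 1`, `c u b ≥ x u b − y v b`, `c u b ≥ 0` (for all edges
`(u,v) ∈ E` and `b ∈ {1,…,k}`) satisfies `c u b ≥ 1` whenever some edge `(u,v) ∈ E` has
`f u < b = f v` or `f u = b < f v`; moreover the 0/1 indicator of this cut condition
itself satisfies all the constraints, and it is pointwise minimal among feasible `c`. -/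
theorem stmt9 {V : Type*} [Fintype V] (E : Finset (V × V)) (k : ℕ) (hk : 1 ≤ k)
    (f : V → ℕ) (hf : ∀ v, f v ∈ Finset.Icc 1 k)
    (y : V → ℕ → ℝ) (hy : ∀ v b, y v b = if f v ≤ b then 1 else 0)
    (x : V → ℕ → ℝ) (hx : ∀ v b, x v b = y v b - y v (b - 1))
    (c : V → ℕ → ℝ)
    (hc1 : ∀ e ∈ E, ∀ b, 1 ≤ b → b ≤ k → y e.1 (b - 1) + x e.2 b - 1 ≤ c e.1 b)
    (hc2 : ∀ e ∈ E, ∀ b, 1 ≤ b → b ≤ k → x e.1 b - y e.2 b ≤ c e.1 b)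
    (hc3 : ∀ e ∈ E, ∀ b, 1 ≤ b → b ≤ k → 0 ≤ c e.1 b)
    (c' : V → ℕ → ℝ)
    (hc' : ∀ u b, c' u b =
      if ∃ v, (u, v) ∈ E ∧ ((f u < b ∧ f v = b) ∨ (f u = b ∧ b < f v)) then 1 else 0) :
    (∀ u : V, ∀ b, 1 ≤ b → b ≤ k →
        (∃ v, (u, v) ∈ E ∧ ((f u < b ∧ f v = b) ∨ (f u = b ∧ b < f v))) → 1 ≤ c u b) ∧
    ((∀ e ∈ E, ∀ b, 1 ≤ b → b ≤ k → y e.1 (b - 1) + x e.2 b - 1 ≤ c' e.1 b) ∧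
     (∀ e ∈ E, ∀ b, 1 ≤ b → b ≤ k → x e.1 b - y e.2 b ≤ c' e.1 b) ∧
     (∀ e ∈ E, ∀ b, 1 ≤ b → b ≤ k → 0 ≤ c' e.1 b)) ∧
    (∀ e ∈ E, ∀ b, 1 ≤ b → b ≤ k → c' e.1 b ≤ c e.1 b) := by
  have hx' : ∀ v b, 1 ≤ b → x v b = if f v = b then 1 else 0 := by
    intro v b hb
    rw [hx, hy, hy]
    split_ifs <;> first | omega | norm_num
  have cut_le : ∀ u : V, ∀ b, 1 ≤ b → b ≤ k →
      (∃ v, (u, v) ∈ E ∧ ((f u < b ∧ f v = b) ∨ (f u = b ∧ b < f v))) → 1 ≤ c u b := by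
    rintro u b hb hbk ⟨v, huv, ⟨hu, hv⟩ | ⟨hu, hv⟩⟩
    · have h := hc1 _ huv b hb hbk
      rw [hy, hx' _ _ hb, if_pos (Nat.le_sub_one_of_lt hu), if_pos hv] at h
      linarith
    · have h := hc2 _ huv b hb hbk
      rw [hy, hx' _ _ hb, if_pos hu, if_neg hv.not_ge] at h
      linarith
  have indicator_nonneg : ∀ u b, 0 ≤ c' u b := by
    intro u b
    rw [hc']
    split_ifs <;> norm_num
  refine ⟨cut_le, ⟨?_, ?_, fun e _ b _ _ => indicator_nonneg e.1 b⟩, ?_⟩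
  · rintro ⟨u, v⟩ huv b hb -
    by_cases h : f u < b ∧ f v = b
    · rw [hc', if_pos ⟨v, huv, Or.inl h⟩, hy, hx' _ _ hb]
      split_ifs <;> norm_num
    · refine le_trans ?_ (indicator_nonneg u b)
      rw [hy, hx' _ _ hb]
      dsimp only
      split_ifs <;> first | omega | norm_num
  · rintro ⟨u, v⟩ huv b hb -
    by_cases h : f u = b ∧ b < f v
    · rw [hc', if_pos ⟨v, huv, Or.inr h⟩, hy, hx' _ _ hb]
      split_ifs <;> norm_num
    · refine le_trans ?_ (indicator_nonneg u b)
      rw [hy, hx' _ _ hb]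
      dsimp only
      split_ifs <;> first | omega | norm_num
  · intro e he b hb hbk
    rw [hc']
    split_ifs with h
    · exact cut_le e.1 b hb hbk h
    · exact hc3 e he b hb hbk
end

section
/- Let G = (V,E) be a computation graph with work : V → ℝ≥0, size_out : V → ℝ≥0, B > 0, and k ≥ 1. Consider the feasible set of the exact MIP: tuples (y, c) with y : V × {0,…,k} → {0,1} monotone in the second argument, y(v,0) = 0, y(v,k) = 1, y(u,b) ≥ y(v,b) for all (u,v) ∈ E and b ∈ {1,…,k}, and c : V × {1,…,k} → ℝ≥0 satisfying c(u,b) ≥ y(u,b−1) + (y(v,b) − y(v,b−1)) − 1 and c(u,b) ≥ (y(u,b) − y(u,b−1)) − y(v,b) for all (u,v) ∈ E and b ∈ {1,…,k}; the objective of (y,c) is max_{b ∈ {1,…,k}} [ Σ_{v ∈ V} work(v)·(y(v,b) − y(v,b−1)) + (1/B)·Σ_{u ∈ V} size_out(u)·c(u,b) ]. Then the minimum of this objective over the feasible set equals OPT, the MTPP optimum, i.e., the minimum bottleneck cost over all DAG-respecting k-partitions f : V → {1,…,k}. -/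
open Finset

attribute [local instance] Classical.propDecidable

/-- The constraints of the exact MIP of Figure 2: `y` is binary and monotone in the block
index with boundary conditions `y v 0 = 0`, `y v k = 1`; the DAG constraints
`y u b ≥ y v b` for edges `(u,v)`; and `c` is nonnegative and satisfies the two tensor
edge-cut constraints (with `x v b = y v b − y v (b−1)` substituted away). -/
def MIPFeasible {V : Type*} [Fintype V] (E : Finset (V × V)) (k : ℕ)
    (y : V → ℕ → ℝ) (c : V → ℕ → ℝ) : Prop :=
  (∀ v : V, ∀ b ≤ k, y v b = 0 ∨ y v b = 1) ∧
  (∀ v : V, y v 0 = 0) ∧ (∀ v : V, y v k = 1) ∧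
  (∀ v : V, ∀ b, 1 ≤ b → b ≤ k → y v (b - 1) ≤ y v b) ∧
  (∀ e ∈ E, ∀ b, 1 ≤ b → b ≤ k → y e.2 b ≤ y e.1 b) ∧
  (∀ (u : V) (b : ℕ), 0 ≤ c u b) ∧
  (∀ e ∈ E, ∀ b, 1 ≤ b → b ≤ k →
    y e.1 (b - 1) + (y e.2 b - y e.2 (b - 1)) - 1 ≤ c e.1 b) ∧
  (∀ e ∈ E, ∀ b, 1 ≤ b → b ≤ k →
    (y e.1 b - y e.1 (b - 1)) - y e.2 b ≤ c e.1 b)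

/-- The objective of the exact MIP: the maximum over blocks `b ∈ {1,…,k}` of
`Σ_v work v · (y v b − y v (b−1)) + (1/B) Σ_u sizeOut u · c u b`. -/
noncomputable def MIPObjective {V : Type*} [Fintype V] (work sizeOut : V → NNReal)
    (B : NNReal) (k : ℕ) (hk : 1 ≤ k) (y : V → ℕ → ℝ) (c : V → ℕ → ℝ) : ℝ :=
  (Finset.Icc 1 k).sup' (Finset.nonempty_Icc.mpr hk)
    (fun b => (∑ v, (work v : ℝ) * (y v b - y v (b - 1))) +
      (1 / (B : ℝ)) * ∑ u, (sizeOut u : ℝ) * c u b)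

/-- The cumulative 0/1 block indicators of a `k`-partition determine the work of each block. -/
lemma sum_work_mul_indicator_diff {V : Type*} [Fintype V] (work : V → NNReal) (f : V → ℕ)
    (y : V → ℕ → ℝ) (b : ℕ) (hb : 1 ≤ b)
    (hy : ∀ v, y v b = if f v ≤ b then 1 else 0)
    (hy' : ∀ v, y v (b - 1) = if f v ≤ b - 1 then 1 else 0) :
    ∑ v, (work v : ℝ) * (y v b - y v (b - 1)) = blockWork work f b := by
  rw [blockWork, Finset.sum_filter]
  refine Finset.sum_congr rfl fun v _ => ?_
  rw [hy, hy']
  rcases lt_trichotomy (f v) b with h | h | h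
  · rw [if_pos h.le, if_pos (by omega), if_neg h.ne]; ring
  · rw [if_pos h.le, if_neg (by omega), if_pos h]; ring
  · rw [if_neg (by omega), if_neg (by omega), if_neg h.ne']; ring

lemma bottleneck_nonneg {V : Type*} [Fintype V] (E : Finset (V × V))
    (work sizeOut : V → NNReal) (B : NNReal) (k : ℕ) (hk : 1 ≤ k) (f : V → ℕ) :
    0 ≤ bottleneck E work sizeOut B k hk f :=
  (blockCost_nonneg E work sizeOut B f 1).trans
    (Finset.le_sup' (blockCost E work sizeOut B f) (Finset.mem_Icc.mpr ⟨le_rfl, hk⟩))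

/-- Every DAG-respecting `k`-partition gives a feasible point of the MIP of the same value. -/
lemma exists_feasible_of_partition {V : Type*} [Fintype V] (E : Finset (V × V))
    (work sizeOut : V → NNReal) (B : NNReal) (k : ℕ) (hk : 1 ≤ k) (f : V → ℕ)
    (hf : ∀ v, f v ∈ Finset.Icc 1 k) (hE : ∀ e ∈ E, f e.1 ≤ f e.2) :
    ∃ y c : V → ℕ → ℝ, MIPFeasible E k y c ∧
      MIPObjective work sizeOut B k hk y c = bottleneck E work sizeOut B k hk f := by
  simp only [Finset.mem_Icc] at hf
  refine ⟨fun v b => if f v ≤ b then 1 else 0,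
    fun u b => if ∃ v, (u, v) ∈ E ∧ ((f u < b ∧ f v = b) ∨ (f u = b ∧ b < f v)) then 1 else 0,
    ⟨?_, ?_, ?_, ?_, ?_, ?_, ?_, ?_⟩, ?_⟩
  · intro v b _
    dsimp only
    split_ifs <;> simp
  · intro v
    exact if_neg (by have := hf v; omega)
  · intro v
    exact if_pos (hf v).2
  · intro v b _ _
    dsimp only
    split_ifs <;> first | omega | norm_num
  · intro e he b _ _
    have := hE e he
    dsimp only
    split_ifs <;> first | omega | norm_num
  · intro u b
    dsimp only
    split_ifs <;> norm_num
  · rintro ⟨u, v⟩ he b hb _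
    by_cases h : f u < b ∧ f v = b
    · have hc : ∃ w, (u, w) ∈ E ∧ ((f u < b ∧ f w = b) ∨ (f u = b ∧ b < f w)) :=
        ⟨v, he, Or.inl h⟩
      dsimp only
      rw [if_pos hc]
      split_ifs <;> norm_num
    · dsimp only
      split_ifs <;> first | omega | norm_num
  · rintro ⟨u, v⟩ he b hb _
    by_cases h : f u = b ∧ b < f v
    · have hc : ∃ w, (u, w) ∈ E ∧ ((f u < b ∧ f w = b) ∨ (f u = b ∧ b < f w)) :=
        ⟨v, he, Or.inr h⟩
      dsimp only
      rw [if_pos hc]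
      split_ifs <;> norm_num
    · dsimp only
      split_ifs <;> first | omega | norm_num
  · refine Finset.sup'_congr _ rfl fun b hb => ?_
    rw [sum_work_mul_indicator_diff work f (fun v b => if f v ≤ b then 1 else 0) b
      (Finset.mem_Icc.mp hb).1 (fun _ => rfl) (fun _ => rfl), blockCost, cutCost, Finset.sum_filter]
    simp only [mul_ite, mul_one, mul_zero]

/-- Binary monotone rows running from `0` to `1` are the cumulative indicators of a map. -/
lemma exists_threshold {V : Type*} (k : ℕ) (y : V → ℕ → ℝ)
    (hbin : ∀ v, ∀ b ≤ k, y v b = 0 ∨ y v b = 1) (h0 : ∀ v, y v 0 = 0) (h1 : ∀ v, y v k = 1)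
    (hmono : ∀ v, ∀ b, 1 ≤ b → b ≤ k → y v (b - 1) ≤ y v b) :
    ∃ f : V → ℕ, (∀ v, f v ∈ Finset.Icc 1 k) ∧
      ∀ v, ∀ b ≤ k, y v b = if f v ≤ b then 1 else 0 := by
  have hex : ∀ v, ∃ b, y v b = 1 := fun v => ⟨k, h1 v⟩
  refine ⟨fun v => Nat.find (hex v), fun v => ?_, fun v b hb => ?_⟩
  · refine Finset.mem_Icc.mpr ⟨(Nat.one_le_iff_ne_zero).mpr fun h => ?_, Nat.find_min' _ (h1 v)⟩
    have := Nat.find_spec (hex v)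
    dsimp only at h
    rw [h, h0] at this
    norm_num at this
  · split_ifs with h
    · induction b, h using Nat.le_induction with
      | base => exact Nat.find_spec (hex v)
      | succ n hn ih =>
        have hle := hmono v (n + 1) (by omega) hb
        rw [Nat.add_sub_cancel, ih (by omega)] at hle
        rcases hbin v (n + 1) hb with h' | h'
        · rw [h'] at hle; norm_num at hle
        · exact h'
    · exact (hbin v b hb).resolve_right (Nat.find_min (hex v) (not_le.mp h))

/-- Every feasible point of the MIP gives a DAG-respecting `k`-partition of no larger cost. -/
lemma exists_partition_of_feasible {V : Type*} [Fintype V] (E : Finset (V × V))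
    (work sizeOut : V → NNReal) (B : NNReal) (k : ℕ) (hk : 1 ≤ k) (y c : V → ℕ → ℝ)
    (h : MIPFeasible E k y c) :
    ∃ f : V → ℕ, (∀ v, f v ∈ Finset.Icc 1 k) ∧ (∀ e ∈ E, f e.1 ≤ f e.2) ∧
      bottleneck E work sizeOut B k hk f ≤ MIPObjective work sizeOut B k hk y c := by
  obtain ⟨hbin, h0, h1, hmono, hdag, hc, hc1, hc2⟩ := h
  obtain ⟨f, hf, hy⟩ := exists_threshold k y hbin h0 h1 hmono
  refine ⟨f, hf, fun e he => ?_, Finset.sup'_mono_fun fun b hb => ?_⟩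
  · have h2 := Finset.mem_Icc.mp (hf e.2)
    have := hdag e he (f e.2) h2.1 h2.2
    rw [hy _ _ h2.2, hy _ _ h2.2, if_pos le_rfl] at this
    by_contra hlt
    rw [if_neg hlt] at this
    norm_num at this
  · obtain ⟨hb1, hbk⟩ := Finset.mem_Icc.mp hb
    rw [sum_work_mul_indicator_diff work f y b hb1 (fun v => hy v b hbk)
      (fun v => hy v (b - 1) (by omega)), blockCost, cutCost, Finset.sum_filter]
    gcongr with u
    split_ifs with hcut
    · refine le_mul_of_one_le_right (by positivity) ?_
      obtain ⟨v, he, ⟨hu, hv⟩ | ⟨hu, hv⟩⟩ := hcut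
      · have := hc1 (u, v) he b hb1 hbk
        dsimp only at this
        rw [hy _ _ hbk, hy _ (b - 1) (by omega), hy _ (b - 1) (by omega), if_pos (by omega),
          if_pos (by omega), if_neg (by omega)] at this
        linarith
      · have := hc2 (u, v) he b hb1 hbk
        dsimp only at this
        rw [hy _ _ hbk, hy _ (b - 1) (by omega), hy _ _ hbk, if_pos (by omega),
          if_neg (by omega), if_neg (by omega)] at this
        linarith
    · exact mul_nonneg (by positivity) (hc u b)

/-- Theorem 3.1, correctness: the minimum of the exact MIP objective
over its feasible set equals the MTPP optimum, i.e. the minimum bottleneck cost over all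
DAG-respecting `k`-partitions. -/
theorem stmt10 {V : Type*} [Fintype V] (E : Finset (V × V)) (hacyc : IsAcyclicRel E)
    (work sizeOut : V → NNReal) (B : NNReal) (hB : 0 < B) (k : ℕ) (hk : 1 ≤ k) :
    sInf {r : ℝ | ∃ y c : V → ℕ → ℝ,
        MIPFeasible E k y c ∧ MIPObjective work sizeOut B k hk y c = r}
      = OPT E work sizeOut B k hk := by
  have hlower : ∀ r ∈ {r : ℝ | ∃ y c : V → ℕ → ℝ,
      MIPFeasible E k y c ∧ MIPObjective work sizeOut B k hk y c = r}, 0 ≤ r := by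
    rintro _ ⟨y, c, h, rfl⟩
    obtain ⟨f, -, -, hle⟩ := exists_partition_of_feasible E work sizeOut B k hk y c h
    exact (bottleneck_nonneg E work sizeOut B k hk f).trans hle
  have hone : ∀ v : V, (fun _ : V => 1) v ∈ Finset.Icc 1 k :=
    fun _ => Finset.mem_Icc.mpr ⟨le_rfl, hk⟩
  refine le_antisymm (le_csInf ⟨_, fun _ => 1, hone, fun _ _ => le_rfl, rfl⟩ ?_)
    (le_csInf ?_ ?_)
  · rintro _ ⟨f, hf, hE, rfl⟩
    exact csInf_le ⟨0, hlower⟩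
      (exists_feasible_of_partition E work sizeOut B k hk f hf hE)
  · exact ⟨_, exists_feasible_of_partition E work sizeOut B k hk _ hone fun _ _ => le_rfl⟩
  · rintro _ ⟨y, c, h, rfl⟩
    obtain ⟨f, hf, hE, hle⟩ := exists_partition_of_feasible E work sizeOut B k hk y c h
    refine le_trans (csInf_le ⟨0, ?_⟩ ⟨f, hf, hE, rfl⟩) hle
    rintro _ ⟨g, -, -, rfl⟩
    exact bottleneck_nonneg E work sizeOut B k hk g
end

section
/- Let G = (V,E) be a computation graph with work : V → ℝ≥0, size_out : V → ℝ≥0, B > 0, k ≥ 1, and let f : V → {1,…,k} be a DAG-respecting k-partition. Define y(v,b) = 1 if f(v) ≤ b and 0 otherwise, and define c(u,b) = 1 if there exists an edge (u,v) ∈ E with f(u) < b = f(v) or f(u) = b < f(v), and c(u,b) = 0 otherwise. Then (y, c) is feasible for the exact MIP (it satisfies the monotonicity, boundary, DAG, and tensor-cut constraints), and for every b ∈ {1,…,k}, Σ_{v ∈ V} work(v)·(y(v,b) − y(v,b−1)) + (1/B)·Σ_{u ∈ V} size_out(u)·c(u,b) equals the cost of block b under f; hence the MIP objective of (y,c) equals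 the bottleneck cost of f. -/
open Finset

attribute [local instance] Classical.propDecidable

/-- The increment of the step function `[a ≤ ·]` at `b ≥ 1` is the indicator of `a = b`. -/
lemma ite_le_sub_ite_le_pred {a b : ℕ} (hb : 1 ≤ b) :
    ((if a ≤ b then 1 else 0) - (if a ≤ b - 1 then 1 else 0) : ℝ) = if a = b then 1 else 0 := by
  split_ifs <;> first | omega | norm_num

/-- one direction of Theorem 3.1: a DAG-respecting `k`-partition `f`
induces, via the indicator variables `y v b = [f v ≤ b]` and
`c u b = [some edge (u,v) is cut by block b]`, a feasible point of the exact MIP whose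
per-block objective terms equal the block costs of `f`; hence its MIP objective equals
the bottleneck cost of `f`. -/
theorem stmt11 {V : Type*} [Fintype V] (E : Finset (V × V)) (hacyc : IsAcyclicRel E)
    (work sizeOut : V → NNReal) (B : NNReal) (hB : 0 < B) (k : ℕ) (hk : 1 ≤ k)
    (f : V → ℕ) (hf : ∀ v, f v ∈ Finset.Icc 1 k) (hfE : ∀ e ∈ E, f e.1 ≤ f e.2)
    (y : V → ℕ → ℝ) (hy : ∀ v b, y v b = if f v ≤ b then 1 else 0)
    (c : V → ℕ → ℝ) (hc : ∀ u b, c u b =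
      if ∃ v, (u, v) ∈ E ∧ ((f u < b ∧ f v = b) ∨ (f u = b ∧ b < f v)) then 1 else 0) :
    MIPFeasible E k y c ∧
    (∀ b ∈ Finset.Icc 1 k,
      (∑ v, (work v : ℝ) * (y v b - y v (b - 1))) +
          (1 / (B : ℝ)) * ∑ u, (sizeOut u : ℝ) * c u b
        = blockCost E work sizeOut B f b) ∧
    MIPObjective work sizeOut B k hk y c = bottleneck E work sizeOut B k hk f := by
  have hdiff : ∀ v b, 1 ≤ b → y v b - y v (b - 1) = if f v = b then 1 else 0 := by
    intro v b hb
    rw [hy, hy, ite_le_sub_ite_le_pred hb]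
  have hc_nonneg : ∀ u b, 0 ≤ c u b := by
    intro u b
    rw [hc]
    split_ifs <;> norm_num
  have hc_cut : ∀ u v b, (u, v) ∈ E → (f u < b ∧ f v = b) ∨ (f u = b ∧ b < f v) → c u b = 1 := by
    intro u v b huv h
    rw [hc, if_pos ⟨v, huv, h⟩]
  have hcost : ∀ b ∈ Finset.Icc 1 k,
      (∑ v, (work v : ℝ) * (y v b - y v (b - 1))) +
          (1 / (B : ℝ)) * ∑ u, (sizeOut u : ℝ) * c u b
        = blockCost E work sizeOut B f b := by
    intro b hb
    have hb1 := (Finset.mem_Icc.mp hb).1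
    simp only [blockCost, blockWork, cutCost, Finset.sum_filter, hdiff _ b hb1, hc,
      mul_ite, mul_one, mul_zero]
  refine ⟨⟨?_, ?_, ?_, ?_, ?_, hc_nonneg, ?_, ?_⟩, hcost, ?_⟩
  · intro v b _
    rw [hy]
    split_ifs <;> simp
  · intro v
    rw [hy, if_neg (by have := (Finset.mem_Icc.mp (hf v)).1; omega)]
  · intro v
    rw [hy, if_pos (Finset.mem_Icc.mp (hf v)).2]
  · intro v b hb _
    rw [← sub_nonneg, hdiff v b hb]
    split_ifs <;> norm_num
  · intro e he b _ _
    have := hfE e he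
    rw [hy, hy]
    split_ifs <;> first | omega | norm_num
  · intro e he b hb _
    rw [hdiff _ b hb, hy]
    by_cases h : f e.1 ≤ b - 1 ∧ f e.2 = b
    · rw [hc_cut e.1 e.2 b he (Or.inl ⟨by omega, h.2⟩), if_pos h.1, if_pos h.2]
      norm_num
    · refine le_trans ?_ (hc_nonneg e.1 b)
      split_ifs <;> first | omega | norm_num
  · intro e he b hb _
    rw [hdiff _ b hb, hy]
    by_cases h : f e.1 = b ∧ b < f e.2
    · rw [hc_cut e.1 e.2 b he (Or.inr h), if_pos h.1, if_neg (by omega)]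
      norm_num
    · refine le_trans ?_ (hc_nonneg e.1 b)
      split_ifs <;> first | omega | norm_num
  · exact Finset.sup'_congr _ rfl hcost
end

section
/- Let G = (V,E) be a computation graph on a nonempty vertex set with work : V → ℝ≥0, size_out : V → ℝ≥0, B > 0, and k ≥ 1, and let L = max( max_{v ∈ V} work(v), (1/k)·Σ_{v ∈ V} work(v) ). For every DAG-respecting k-partition f : V → {1,…,k}, there exists a block index j ∈ {1,…,k} such that Σ_{v : f(v)=j} work(v) ≥ L and the cost of block j under f is at most the bottleneck cost of f. Consequently, the coarsened 3-partition g with g(v)=1 if f(v)<j, g(v)=2 if f(v)=j, g(v)=3 if f(v)>j is DAG-respecting, has Σ_{v : g(v)=2} work(v) ≥ L, and has cost of block 2 at most the bottleneck cost of f. -/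
open Finset

attribute [local instance] Classical.propDecidable

/-- An upper bound on the work of all `k` blocks of a partition is at least `simpleLB`. -/
theorem simpleLB_le_of_forall_blockWork_le {V : Type*} [Fintype V] [Nonempty V]
    {work : V → NNReal} {k : ℕ} (hk : 1 ≤ k) {f : V → ℕ} (hf : ∀ v, f v ∈ Finset.Icc 1 k)
    {M : ℝ} (hM : ∀ b ∈ Finset.Icc 1 k, blockWork work f b ≤ M) :
    simpleLB work k ≤ M := by
  refine max_le (Finset.sup'_le _ _ fun v _ => le_trans ?_ (hM (f v) (hf v))) ?_
  · exact Finset.single_le_sum (f := fun v => (work v : ℝ)) (fun _ _ => NNReal.coe_nonneg _)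
      (Finset.mem_filter.mpr ⟨Finset.mem_univ v, rfl⟩)
  · have hk' : (0 : ℝ) < k := by exact_mod_cast hk
    rw [div_le_iff₀ hk', ← Finset.sum_fiberwise_of_maps_to fun v _ => hf v]
    have h := Finset.sum_le_card_nsmul _ _ _ hM
    rw [Nat.card_Icc, Nat.add_sub_cancel, nsmul_eq_mul, mul_comm] at h
    exact h

/-- The cost of a block depends only on how each node compares with the block index. -/
theorem blockCost_congr {V : Type*} [Fintype V] {E : Finset (V × V)} {work sizeOut : V → NNReal}
    {B : NNReal} {f g : V → ℕ} {b c : ℕ} (hlt : ∀ v, g v < c ↔ f v < b)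
    (heq : ∀ v, g v = c ↔ f v = b) (hgt : ∀ v, c < g v ↔ b < f v) :
    blockCost E work sizeOut B g c = blockCost E work sizeOut B f b := by
  simp only [blockCost, blockWork, cutCost, hlt, heq, hgt]

/-- the construction in the proof of Corollary 3.3: every
DAG-respecting `k`-partition `f` has a block `j` whose work is at least
`L = max(max_v work v, (1/k) Σ_v work v)` and whose cost is at most the bottleneck cost
of `f`; the coarsened `3`-partition `g` (`g v = 1` if `f v < j`, `2` if `f v = j`, `3` if
`f v > j`) is DAG-respecting, has `Σ_{g v = 2} work v ≥ L`, and its block `2` costs at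
most the bottleneck cost of `f`. -/
theorem stmt13 {V : Type*} [Fintype V] [Nonempty V] (E : Finset (V × V))
    (hacyc : IsAcyclicRel E) (work sizeOut : V → NNReal) (B : NNReal) (hB : 0 < B)
    (k : ℕ) (hk : 1 ≤ k) (f : V → ℕ) (hf : ∀ v, f v ∈ Finset.Icc 1 k)
    (hfE : ∀ e ∈ E, f e.1 ≤ f e.2) :
    ∃ j ∈ Finset.Icc 1 k,
      simpleLB work k ≤ blockWork work f j ∧
      blockCost E work sizeOut B f j ≤ bottleneck E work sizeOut B k hk f ∧
      ∀ g : V → ℕ, (∀ v, g v = if f v < j then 1 else if f v = j then 2 else 3) →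
        (∀ v, g v ∈ Finset.Icc 1 3) ∧ (∀ e ∈ E, g e.1 ≤ g e.2) ∧
        simpleLB work k ≤ blockWork work g 2 ∧
        blockCost E work sizeOut B g 2 ≤ bottleneck E work sizeOut B k hk f := by
  obtain ⟨j, hj, hmax⟩ :=
    Finset.exists_max_image (Finset.Icc 1 k) (blockWork work f) (Finset.nonempty_Icc.mpr hk)
  have hL : simpleLB work k ≤ blockWork work f j :=
    simpleLB_le_of_forall_blockWork_le hk hf hmax
  have hcost : blockCost E work sizeOut B f j ≤ bottleneck E work sizeOut B k hk f :=
    Finset.le_sup' (blockCost E work sizeOut B f) hj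
  refine ⟨j, hj, hL, hcost, fun g hg => ?_⟩
  have hlt : ∀ v, g v < 2 ↔ f v < j := fun v => by rw [hg v]; split_ifs <;> omega
  have heq : ∀ v, g v = 2 ↔ f v = j := fun v => by rw [hg v]; split_ifs <;> omega
  have hgt : ∀ v, 2 < g v ↔ j < f v := fun v => by rw [hg v]; split_ifs <;> omega
  refine ⟨fun v => ?_, fun e he => ?_, ?_, ?_⟩
  · rw [Finset.mem_Icc, hg v]
    split_ifs <;> omega
  · have h := hfE e he
    rw [hg, hg]
    split_ifs <;> omega
  · simpa only [blockWork, heq] using hL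
  · rwa [blockCost_congr hlt heq hgt]
end
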